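/- If two concrete C*-algebras are strongly TRO equivalent then they are strongly Morita equivalent in the sense of Rieffel: Let H, K be complex Hilbert spaces, let A ⊆ B(H) and B ⊆ B(K) be norm-closed *-subalgebras, and let M ⊆ B(H,K) be a TRO with A = [M*BM] and B = [MAM*]. Then N := [{b m : b ∈ B, m ∈ M}] ⊆ B(H,K) satisfies N N* N ⊆ N (so N is a TRO), A = [N*N], and B = [NN*]. -/

import Mathlib

noncomputable section

open ContinuousLinearMap

/-- The norm-closed linear span of a set of operators. -/
def clspan {V : Type*} [NormedAddCommGroup V] [NormedSpace ℂ V] (S : Set V) : Set V :=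
  closure (Submodule.span ℂ S : Set V)

/-- A set is a norm-closed linear subspace. -/
def IsClosedSubspace {V : Type*} [NormedAddCommGroup V] [NormedSpace ℂ V] (S : Set V) : Prop :=
  IsClosed S ∧ ∃ p : Submodule ℂ V, (p : Set V) = S

variable {H K L R : Type*}
  [NormedAddCommGroup H] [InnerProductSpace ℂ H] [CompleteSpace H]
  [NormedAddCommGroup K] [InnerProductSpace ℂ K] [CompleteSpace K]
  [NormedAddCommGroup L] [InnerProductSpace ℂ L] [CompleteSpace L]
  [NormedAddCommGroup R] [InnerProductSpace ℂ R] [CompleteSpace R]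

/-- A ternary ring of operators: a norm-closed subspace `M ⊆ B(H,K)` with `M M* M ⊆ M`. -/
def IsTRO (M : Set (H →L[ℂ] K)) : Prop :=
  IsClosedSubspace M ∧
    ∀ m₁ ∈ M, ∀ m₂ ∈ M, ∀ m₃ ∈ M, m₁ ∘L ((adjoint m₂) ∘L m₃) ∈ M

/-- A norm-closed subalgebra of `B(H)`. -/
def IsClosedSubalgebra (A : Set (H →L[ℂ] H)) : Prop :=
  IsClosedSubspace A ∧ ∀ a ∈ A, ∀ b ∈ A, a * b ∈ A

/-- `[M* B M]`, the norm-closed linear span of `{m₁* b m₂ : m₁, m₂ ∈ M, b ∈ B}`. -/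
def conjTRO (M : Set (H →L[ℂ] K)) (B : Set (K →L[ℂ] K)) : Set (H →L[ℂ] H) :=
  clspan {x | ∃ m₁ ∈ M, ∃ m₂ ∈ M, ∃ b ∈ B, x = (adjoint m₁) ∘L (b ∘L m₂)}

/-- `[M A M*]`, the norm-closed linear span of `{m₁ a m₂* : m₁, m₂ ∈ M, a ∈ A}`. -/
def conjTRO' (M : Set (H →L[ℂ] K)) (A : Set (H →L[ℂ] H)) : Set (K →L[ℂ] K) :=
  clspan {x | ∃ m₁ ∈ M, ∃ m₂ ∈ M, ∃ a ∈ A, x = m₁ ∘L (a ∘L (adjoint m₂))}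

/-- An algebra `A ⊆ B(H)` acts nondegenerately: the span of `A(H)` is dense in `H`. -/
def Nondegenerate (A : Set (H →L[ℂ] H)) : Prop :=
  Dense (Submodule.span ℂ {v : H | ∃ a ∈ A, ∃ h : H, v = a h} : Set H)

/-- A contractive approximate identity for `A`: a net `(e t)` in the unit ball of `A`
with `‖e t * a - a‖ → 0` and `‖a * e t - a‖ → 0` for every `a ∈ A`. -/
def HasCai (A : Set (H →L[ℂ] H)) : Prop :=
  ∃ (ι : Type) (_ : Preorder ι) (_ : IsDirected ι (· ≤ ·)) (_ : Nonempty ι)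
    (e : ι → (H →L[ℂ] H)),
    (∀ t, e t ∈ A) ∧ (∀ t, ‖e t‖ ≤ 1) ∧
    ∀ a ∈ A, Filter.Tendsto (fun t => ‖e t * a - a‖) Filter.atTop (nhds 0) ∧
      Filter.Tendsto (fun t => ‖a * e t - a‖) Filter.atTop (nhds 0)

/-- A countable approximate identity for `A`: a sequence `(e n)` in `A` with
`‖e n * a - a‖ → 0` and `‖a * e n - a‖ → 0` for every `a ∈ A`. -/
def HasCountableAI (A : Set (H →L[ℂ] H)) : Prop :=
  ∃ e : ℕ → (H →L[ℂ] H), (∀ n, e n ∈ A) ∧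
    ∀ a ∈ A, Filter.Tendsto (fun n => ‖e n * a - a‖) Filter.atTop (nhds 0) ∧
      Filter.Tendsto (fun n => ‖a * e n - a‖) Filter.atTop (nhds 0)

/-- The operator on the ℓ²-direct sum `R^n` associated to an `n × n` matrix of operators. -/
def matrixOp {n : ℕ} (x : Fin n → Fin n → (R →L[ℂ] R)) :
    (PiLp 2 fun _ : Fin n => R) →L[ℂ] (PiLp 2 fun _ : Fin n => R) :=
  ((PiLp.continuousLinearEquiv 2 ℂ (fun _ : Fin n => R)).symm.toContinuousLinearMap.comp
      (ContinuousLinearMap.pi fun i =>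
        ∑ j, (x i j).comp (ContinuousLinearMap.proj j))).comp
    (PiLp.continuousLinearEquiv 2 ℂ (fun _ : Fin n => R)).toContinuousLinearMap

/-- `φ` is completely isometric on a subspace `A ⊆ B(R)`: every matrix amplification of `φ`
preserves the operator matrix norms. -/
def CompletelyIsometricOn (A : Set (R →L[ℂ] R)) (φ : (R →L[ℂ] R) → (H →L[ℂ] H)) : Prop :=
  ∀ (n : ℕ) (x : Fin n → Fin n → (R →L[ℂ] R)), (∀ i j, x i j ∈ A) →
    ‖matrixOp (fun i j => φ (x i j))‖ = ‖matrixOp x‖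

/-- `α` is a completely isometric nondegenerate representation of the operator algebra
`A ⊆ B(R)` on the Hilbert space `H`: it is linear and multiplicative on `A`,
completely isometric on `A`, and the span of `α(A)H` is dense in `H`. -/
def IsCIRepOn (A : Set (R →L[ℂ] R)) (α : (R →L[ℂ] R) → (H →L[ℂ] H)) : Prop :=
  (∀ a ∈ A, ∀ b ∈ A, α (a + b) = α a + α b) ∧
  (∀ (c : ℂ), ∀ a ∈ A, α (c • a) = c • α a) ∧
  (∀ a ∈ A, ∀ b ∈ A, α (a * b) = α a * α b) ∧
  CompletelyIsometricOn A α ∧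
  Dense (Submodule.span ℂ {v : H | ∃ a ∈ A, ∃ h : H, v = α a h} : Set H)

/-- Two concretely represented operator algebras are strongly TRO equivalent. -/
def StronglyTROEquivalent (X : Set (H →L[ℂ] H)) (Y : Set (K →L[ℂ] K)) : Prop :=
  ∃ M : Set (H →L[ℂ] K), IsTRO M ∧ X = conjTRO M Y ∧ Y = conjTRO' M X

/-- Two operator algebras are strongly Δ-equivalent: they admit completely isometric
nondegenerate representations with strongly TRO equivalent ranges. -/
def StronglyDeltaEquivalent (A : Set (H →L[ℂ] H)) (B : Set (K →L[ℂ] K)) : Prop :=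
  ∃ (H' K' : Type) (_ : NormedAddCommGroup H') (_ : InnerProductSpace ℂ H')
    (_ : CompleteSpace H') (_ : NormedAddCommGroup K') (_ : InnerProductSpace ℂ K')
    (_ : CompleteSpace K')
    (α : (H →L[ℂ] H) → (H' →L[ℂ] H')) (β : (K →L[ℂ] K) → (K' →L[ℂ] K')),
    IsCIRepOn A α ∧ IsCIRepOn B β ∧ StronglyTROEquivalent (α '' A) (β '' B)

/-- The Hilbert space `ℓ²(H)` of square-summable sequences in `H`. -/
abbrev l2 (H : Type*) [NormedAddCommGroup H] [InnerProductSpace ℂ H] : Type _ :=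
  lp (fun _ : ℕ => H) 2

/-- The isometric embedding `S_i` of `H` onto the `i`-th coordinate of `ℓ²(H)`. -/
def lpSingle (i : ℕ) : H →L[ℂ] l2 H :=
  LinearMap.mkContinuous
    { toFun := fun a => lp.single 2 i a
      map_add' := fun a b => by
        apply lp.ext
        funext j
        by_cases h : j = i
        · subst h; simp [lp.single_apply_self]
        · simp [lp.single_apply_ne _ _ _ h, lp.coeFn_add]
      map_smul' := fun c a => by simp }
    1 (fun a => by
      simpa using (lp.norm_single (p := 2) (by norm_num) (fun _ : ℕ => a) i).le)

/-- The stabilization `K_∞(A) = [{S_i a S_j* : a ∈ A, i, j ∈ ℕ}] ⊆ B(ℓ²(H))`. -/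
def Kinf (A : Set (H →L[ℂ] H)) : Set (l2 H →L[ℂ] l2 H) :=
  clspan {x | ∃ a ∈ A, ∃ i j : ℕ, x = (lpSingle i) ∘L (a ∘L (adjoint (lpSingle j)))}


theorem aux_clspan_closed {V : Type*} [NormedAddCommGroup V] [NormedSpace ℂ V] (S : Set V) :
    IsClosedSubspace (clspan S) :=
  ⟨isClosed_closure, (Submodule.span ℂ S).topologicalClosure, rfl⟩

theorem aux_subset_clspan {V : Type*} [NormedAddCommGroup V] [NormedSpace ℂ V] {S : Set V}
    {x : V} (hx : x ∈ S) : x ∈ clspan S :=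
  subset_closure (Submodule.subset_span hx)

theorem aux_map_span {V W : Type*} [NormedAddCommGroup V] [NormedSpace ℂ V]
    [NormedAddCommGroup W] [NormedSpace ℂ W] {S : Set V} {T : Set W} (f : V → W)
    (hadd : ∀ x y, f (x + y) = f x + f y)
    (hsmul : ∀ (c : ℂ) x, ∃ d : ℂ, f (c • x) = d • f x)
    (hT : IsClosedSubspace T) (h : ∀ x ∈ S, f x ∈ T) :
    ∀ x ∈ Submodule.span ℂ S, f x ∈ T := by
  obtain ⟨-, p, rfl⟩ := hT
  intro x hx
  induction hx using Submodule.span_induction with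
  | mem x hx => exact h x hx
  | zero =>
    have h0 : f 0 = 0 := by simpa using hadd 0 0
    rw [h0]; exact p.zero_mem
  | add x y _ _ hx hy => rw [hadd]; exact p.add_mem hx hy
  | smul c x _ hx =>
    obtain ⟨d, hd⟩ := hsmul c x
    rw [hd]; exact p.smul_mem d hx

theorem aux_map_clspan {V W : Type*} [NormedAddCommGroup V] [NormedSpace ℂ V]
    [NormedAddCommGroup W] [NormedSpace ℂ W] {S : Set V} {T : Set W} (f : V → W)
    (hc : Continuous f)
    (hadd : ∀ x y, f (x + y) = f x + f y)
    (hsmul : ∀ (c : ℂ) x, ∃ d : ℂ, f (c • x) = d • f x)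
    (hT : IsClosedSubspace T) (h : ∀ x ∈ S, f x ∈ T) :
    ∀ x ∈ clspan S, f x ∈ T := by
  intro x hx
  have h1 := aux_map_span f hadd hsmul hT h
  exact closure_minimal (t := f ⁻¹' T) h1 (hT.1.preimage hc) hx

theorem aux_clspan_sub {V : Type*} [NormedAddCommGroup V] [NormedSpace ℂ V]
    {S T : Set V} (hT : IsClosedSubspace T) (h : ∀ x ∈ S, x ∈ T) : clspan S ⊆ T :=
  aux_map_clspan id continuous_id (fun _ _ => rfl) (fun c _ => ⟨c, rfl⟩) hT h

theorem aux_cstar_span {A : Type*} [NonUnitalCStarAlgebra A] (a : A) :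
    a ∈ Submodule.span ℂ {x : A | ∃ c d : A, x = c * d} := by
  let _ := CStarAlgebra.spectralOrder A
  have _ := CStarAlgebra.spectralOrderedRing A
  have h : a ∈ Submodule.span ℂ {a : A | 0 ≤ a} := by
    rw [CStarAlgebra.span_nonneg]; trivial
  refine Submodule.span_mono ?_ h
  intro x hx
  exact ⟨CFC.sqrt x, CFC.sqrt x, (CFC.sqrt_mul_sqrt_self x hx).symm⟩

theorem aux_factor {A : Set (H →L[ℂ] H)} (hA : IsClosedSubalgebra A)
    (hs : ∀ a ∈ A, star a ∈ A) :
    ∀ a ∈ A, a ∈ Submodule.span ℂ {x | ∃ c ∈ A, ∃ d ∈ A, x = c * d} := by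
  obtain ⟨⟨hcl, p, rfl⟩, hmul⟩ := hA
  let s : NonUnitalStarSubalgebra ℂ (H →L[ℂ] H) :=
    { p with
      mul_mem' := fun {a b} ha hb => hmul a ha b hb
      star_mem' := fun {a} ha => hs a ha }
  have : IsClosed (s : Set (H →L[ℂ] H)) := hcl
  intro a ha
  have h := aux_cstar_span (⟨a, ha⟩ : s)
  have h2 := Submodule.mem_map_of_mem (f :=
    ({ toFun := fun x => x.1, map_add' := fun _ _ => rfl, map_smul' := fun _ _ => rfl } :
      s →ₗ[ℂ] (H →L[ℂ] H))) h
  rw [Submodule.map_span] at h2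
  refine Submodule.span_mono ?_ h2
  rintro _ ⟨_, ⟨c, d, rfl⟩, rfl⟩
  exact ⟨c, c.2, d, d.2, rfl⟩

/-- If two concrete C*-algebras are strongly TRO equivalent via `M`, then
`N = [B M]` is a TRO with `A = [N* N]` and `B = [N N*]`, i.e. they are strongly Morita
equivalent in the sense of Rieffel. -/
theorem cstar_strongTRO_implies_Rieffel
    (A : Set (H →L[ℂ] H)) (B : Set (K →L[ℂ] K))
    (hA : IsClosedSubalgebra A) (hB : IsClosedSubalgebra B)
    (hAstar : ∀ a ∈ A, star a ∈ A) (hBstar : ∀ b ∈ B, star b ∈ B)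
    (M : Set (H →L[ℂ] K)) (hM : IsTRO M)
    (hAB : A = conjTRO M B) (hBA : B = conjTRO' M A)
    (N : Set (H →L[ℂ] K)) (hN : N = clspan {x | ∃ b ∈ B, ∃ m ∈ M, x = b ∘L m}) :
    (∀ n₁ ∈ N, ∀ n₂ ∈ N, ∀ n₃ ∈ N, n₁ ∘L ((adjoint n₂) ∘L n₃) ∈ N) ∧
      A = clspan {x | ∃ n₁ ∈ N, ∃ n₂ ∈ N, x = (adjoint n₁) ∘L n₂} ∧
      B = clspan {x | ∃ n₁ ∈ N, ∃ n₂ ∈ N, x = n₁ ∘L (adjoint n₂)} := by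
  have hNc : IsClosedSubspace N := hN ▸ aux_clspan_closed _
  have adjc : Continuous fun x : H →L[ℂ] K => adjoint x :=
    (adjoint (𝕜 := ℂ) (E := H) (F := K)).continuous
  have hNmem : ∀ b ∈ B, ∀ m ∈ M, b ∘L m ∈ N := fun b hb m hm => by
    rw [hN]; exact aux_subset_clspan ⟨b, hb, m, hm, rfl⟩
  have hAmem : ∀ m₁ ∈ M, ∀ m₂ ∈ M, ∀ b ∈ B, adjoint m₁ ∘L (b ∘L m₂) ∈ A :=
    fun m₁ h₁ m₂ h₂ b hb => by
      rw [hAB]; exact aux_subset_clspan ⟨m₁, h₁, m₂, h₂, b, hb, rfl⟩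
  have hBmem : ∀ m₁ ∈ M, ∀ m₂ ∈ M, ∀ a ∈ A, m₁ ∘L (a ∘L adjoint m₂) ∈ B :=
    fun m₁ h₁ m₂ h₂ a ha => by
      rw [hBA]; exact aux_subset_clspan ⟨m₁, h₁, m₂, h₂, a, ha, rfl⟩
  have hMMB : ∀ m₁ ∈ M, ∀ m₂ ∈ M, ∀ b ∈ B, m₁ ∘L (adjoint m₂ ∘L b) ∈ B := by
    intro m₁ h₁ m₂ h₂ b hb
    rw [hBA] at hb
    refine aux_map_clspan (fun x => m₁ ∘L (adjoint m₂ ∘L x)) (by fun_prop)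
      (fun x y => by simp [comp_add]) (fun c x => ⟨c, by simp [comp_smul]⟩) hB.1 ?_ b hb
    rintro _ ⟨m₃, h₃, m₄, h₄, a, ha, rfl⟩
    exact hBmem _ (hM.2 m₁ h₁ m₂ h₂ m₃ h₃) m₄ h₄ a ha
  -- elimination for `N`
  have hNN : ∀ n₁ ∈ N, ∀ n₂ ∈ N, n₁ ∘L adjoint n₂ ∈ B := by
    intro n₁ h₁ n₂ h₂
    rw [hN] at h₁
    refine aux_map_clspan (fun x => x ∘L adjoint n₂) (by fun_prop)
      (fun x y => by simp [add_comp]) (fun c x => ⟨c, by simp [smul_comp]⟩) hB.1 ?_ n₁ h₁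
    rintro _ ⟨b, hb, m, hm, rfl⟩
    rw [hN] at h₂
    refine aux_map_clspan (fun x => (b ∘L m) ∘L adjoint x) (by fun_prop)
      (fun x y => by simp [comp_add]) (fun c x => ⟨star c, by
        simp only [map_smulₛₗ adjoint c x, comp_smul]; rfl⟩) hB.1 ?_ n₂ h₂
    rintro _ ⟨b', hb', m', hm', rfl⟩
    have := hB.2 b hb _ (hMMB m hm m' hm' (star b') (hBstar b' hb'))
    simp only [adjoint_comp]
    exact this
  have hNsN : ∀ n₁ ∈ N, ∀ n₂ ∈ N, adjoint n₁ ∘L n₂ ∈ A := by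
    intro n₁ h₁ n₂ h₂
    rw [hN] at h₁
    refine aux_map_clspan (fun x => adjoint x ∘L n₂) (by fun_prop)
      (fun x y => by simp [add_comp]) (fun c x => ⟨star c, by
        simp only [map_smulₛₗ adjoint c x, smul_comp]; rfl⟩) hA.1 ?_ n₁ h₁
    rintro _ ⟨b, hb, m, hm, rfl⟩
    rw [hN] at h₂
    refine aux_map_clspan (fun x => adjoint (b ∘L m) ∘L x) (by fun_prop)
      (fun x y => by simp [comp_add]) (fun c x => ⟨c, by simp [comp_smul]⟩) hA.1 ?_ n₂ h₂
    rintro _ ⟨b', hb', m', hm', rfl⟩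
    have := hAmem m hm m' hm' _ (hB.2 _ (hBstar b hb) b' hb')
    simp only [adjoint_comp]
    exact this
  have hBN : ∀ b ∈ B, ∀ n ∈ N, b ∘L n ∈ N := by
    intro b hb n hn
    rw [hN] at hn
    refine aux_map_clspan (fun x => b ∘L x) (by fun_prop)
      (fun x y => by simp [comp_add]) (fun c x => ⟨c, by simp [comp_smul]⟩) hNc ?_ n hn
    rintro _ ⟨b', hb', m', hm', rfl⟩
    exact hNmem _ (hB.2 b hb b' hb') m' hm'
  have hMA : ∀ m ∈ M, ∀ a ∈ A, m ∘L a ∈ N := by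
    intro m hm a ha
    rw [hAB] at ha
    refine aux_map_clspan (fun x => m ∘L x) (by fun_prop)
      (fun x y => by simp [comp_add]) (fun c x => ⟨c, by simp [comp_smul]⟩) hNc ?_ a ha
    rintro _ ⟨m₁, h₁, m₂, h₂, b, hb, rfl⟩
    exact hNmem _ (hMMB m hm m₁ h₁ b hb) m₂ h₂
  refine ⟨?_, ?_, ?_⟩
  · intro n₁ h₁ n₂ h₂ n₃ h₃
    exact hBN _ (hNN n₁ h₁ n₂ h₂) n₃ h₃
  · apply Set.Subset.antisymm
    · intro a ha
      rw [hAB] at ha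
      refine aux_clspan_sub (aux_clspan_closed _) ?_ ha
      rintro _ ⟨m₁, h₁, m₂, h₂, b, hb, rfl⟩
      refine aux_map_span (fun x => adjoint m₁ ∘L (x ∘L m₂))
        (fun x y => by simp [comp_add, add_comp])
        (fun c x => ⟨c, by simp [comp_smul, smul_comp]⟩)
        (aux_clspan_closed _) ?_ b (aux_factor hB hBstar b hb)
      rintro _ ⟨c, hc, d, hd, rfl⟩
      refine aux_subset_clspan ⟨star c ∘L m₁, hNmem _ (hBstar c hc) _ h₁, d ∘L m₂,
        hNmem _ hd _ h₂, ?_⟩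
      rw [adjoint_comp, star_eq_adjoint, adjoint_adjoint]
      rfl
    · refine aux_clspan_sub hA.1 ?_
      rintro _ ⟨n₁, h₁, n₂, h₂, rfl⟩
      exact hNsN n₁ h₁ n₂ h₂
  · apply Set.Subset.antisymm
    · intro b hb
      rw [hBA] at hb
      refine aux_clspan_sub (aux_clspan_closed _) ?_ hb
      rintro _ ⟨m₁, h₁, m₂, h₂, a, ha, rfl⟩
      refine aux_map_span (fun x => m₁ ∘L (x ∘L adjoint m₂))
        (fun x y => by simp [comp_add, add_comp])
        (fun c x => ⟨c, by simp [comp_smul, smul_comp]⟩)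
        (aux_clspan_closed _) ?_ a (aux_factor hA hAstar a ha)
      rintro _ ⟨c, hc, d, hd, rfl⟩
      refine aux_subset_clspan ⟨m₁ ∘L c, hMA _ h₁ _ hc, m₂ ∘L star d,
        hMA _ h₂ _ (hAstar d hd), ?_⟩
      rw [adjoint_comp, star_eq_adjoint, adjoint_adjoint]
      rfl
    · refine aux_clspan_sub hB.1 ?_
      rintro _ ⟨n₁, h₁, n₂, h₂, rfl⟩
      exact hNN n₁ h₁ n₂ h₂
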